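/- Let x ∈ V solve b(x,φ) = −α^{−1/2}⟨u_d, Iφ₁⟩_W for all φ ∈ V and let x_h ∈ V_h be its Galerkin approximation, i.e. b(x_h,φ_h) = −α^{−1/2}⟨u_d, Iφ_{h,1}⟩_W for all φ_h ∈ V_h. Then ‖x − x_h‖ ≤ κ_h·μ_h·inf_{v_h ∈ V_h}‖x − v_h‖, where κ_h = ((1+2L)/(1+L))·(1 + M(1 + 2M/√α)·μ_h) with L = M/√α. -/

import Mathlib

open scoped RealInnerProductSpace
open Filter Topology

noncomputable section Setup

variable {V₁ V₂ Q W : Type*}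
  [NormedAddCommGroup V₁] [InnerProductSpace ℝ V₁]
  [NormedAddCommGroup V₂] [InnerProductSpace ℝ V₂]
  [NormedAddCommGroup Q] [InnerProductSpace ℝ Q]
  [NormedAddCommGroup W] [InnerProductSpace ℝ W]

/-- The ℓ²-norm on the product space `V = V₁ × V₂`. -/
def nV (v : V₁ × V₂) : ℝ := Real.sqrt (‖v.1‖ ^ 2 + ‖v.2‖ ^ 2)

/-- The seminorm `|v| = (‖I v₁‖² + ‖C* v₂‖²)^{1/2}`. -/
def sV (Cs : V₂ →L[ℝ] Q) (Iop : V₁ →L[ℝ] W) (v : V₁ × V₂) : ℝ :=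
  Real.sqrt (‖Iop v.1‖ ^ 2 + ‖Cs v.2‖ ^ 2)

/-- The vectorized bilinear form `a(v,φ) = a(v₁,φ₂) + a(φ₁,v₂)` on `V × V`. -/
def aV (a : V₁ →L[ℝ] V₂ →L[ℝ] ℝ) (v φ : V₁ × V₂) : ℝ := a v.1 φ.2 + a φ.1 v.2

/-- The bilinear form `b = a + α^{-1/2} c` of the rescaled reduced optimality system. -/
def bV (a : V₁ →L[ℝ] V₂ →L[ℝ] ℝ) (Cs : V₂ →L[ℝ] Q) (Iop : V₁ →L[ℝ] W) (α : ℝ)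
    (v φ : V₁ × V₂) : ℝ :=
  aV a v φ + (Real.sqrt α)⁻¹ * (⟪Cs v.2, Cs φ.2⟫ - ⟪Iop v.1, Iop φ.1⟫)

/-- Continuity constant `M_a = sup { a(v₁,v₂) : ‖v₁‖ = 1, ‖v₂‖ = 1 }`. -/
def contConst (a : V₁ →L[ℝ] V₂ →L[ℝ] ℝ) : ℝ :=
  sSup {r : ℝ | ∃ v₁ : V₁, ∃ v₂ : V₂, ‖v₁‖ = 1 ∧ ‖v₂‖ = 1 ∧ r = a v₁ v₂}

/-- Inf-sup constant `m_a = inf_{‖v₂‖=1} sup_{‖v₁‖=1} a(v₁,v₂)`. -/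
def infSupConst (a : V₁ →L[ℝ] V₂ →L[ℝ] ℝ) : ℝ :=
  sInf {r : ℝ | ∃ v₂ : V₂, ‖v₂‖ = 1 ∧
    r = sSup {s : ℝ | ∃ v₁ : V₁, ‖v₁‖ = 1 ∧ s = a v₁ v₂}}

/-- Discrete inf-sup constant of `a` on `V_{h,1} × V_{h,2}`. -/
def discInfSup (a : V₁ →L[ℝ] V₂ →L[ℝ] ℝ) (Vh1 : Submodule ℝ V₁)
    (Vh2 : Submodule ℝ V₂) : ℝ :=
  sInf {r : ℝ | ∃ v₁ ∈ Vh1, ‖v₁‖ = 1 ∧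
    r = sSup {s : ℝ | ∃ φ₂ ∈ Vh2, ‖φ₂‖ = 1 ∧ s = a v₁ φ₂}}

/-- Best approximation error `inf_{v_h ∈ V_h} ‖x - v_h‖` in the product norm. -/
def bestErr (Vh1 : Submodule ℝ V₁) (Vh2 : Submodule ℝ V₂) (x : V₁ × V₂) : ℝ :=
  sInf {r : ℝ | ∃ vh : V₁ × V₂, vh.1 ∈ Vh1 ∧ vh.2 ∈ Vh2 ∧ r = nV (x - vh)}

/-- The quasi-best-approximation constant `ν_h` of the Galerkin discretization of `b`:
`sup` over nonzero discrete test functions of the ratio of the continuous sup to the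
discrete sup. -/
def nuConst (a : V₁ →L[ℝ] V₂ →L[ℝ] ℝ) (Cs : V₂ →L[ℝ] Q) (Iop : V₁ →L[ℝ] W) (α : ℝ)
    (Vh1 : Submodule ℝ V₁) (Vh2 : Submodule ℝ V₂) : ℝ :=
  sSup {r : ℝ | ∃ φh : V₁ × V₂, φh.1 ∈ Vh1 ∧ φh.2 ∈ Vh2 ∧ φh ≠ 0 ∧
    r = sSup {s : ℝ | ∃ v : V₁ × V₂, nV v = 1 ∧ s = bV a Cs Iop α v φh} /
        sSup {s : ℝ | ∃ vh : V₁ × V₂, vh.1 ∈ Vh1 ∧ vh.2 ∈ Vh2 ∧ nV vh = 1 ∧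
          s = bV a Cs Iop α vh φh}}

/-- The nonlinear form `c_{K,α}` associated with the control constraint set `K`
(through its metric projection `PK`). -/
def cK (Cs : V₂ →L[ℝ] Q) (Iop : V₁ →L[ℝ] W) (PK : Q → Q) (α : ℝ) (v φ : V₁ × V₂) : ℝ :=
  -⟪PK ((-(Real.sqrt α)⁻¹) • (Cs v.2)), Cs φ.2⟫ - (Real.sqrt α)⁻¹ * ⟪Iop v.1, Iop φ.1⟫

/-- The nonlinear form `b_K = a + c_{K,α}`. -/
def bK (a : V₁ →L[ℝ] V₂ →L[ℝ] ℝ) (Cs : V₂ →L[ℝ] Q) (Iop : V₁ →L[ℝ] W) (PK : Q → Q)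
    (α : ℝ) (v φ : V₁ × V₂) : ℝ :=
  aV a v φ + cK Cs Iop PK α v φ

/-- The pseudometric `δ_{K,α}`. -/
def deltaK (Cs : V₂ →L[ℝ] Q) (Iop : V₁ →L[ℝ] W) (PK : Q → Q) (α : ℝ)
    (v w : V₁ × V₂) : ℝ :=
  Real.sqrt (α * ‖PK ((-(Real.sqrt α)⁻¹) • (Cs v.2)) -
      PK ((-(Real.sqrt α)⁻¹) • (Cs w.2))‖ ^ 2 + ‖Iop (v.1 - w.1)‖ ^ 2)

end Setup

/-- A bilinear form that is nondegenerate on a pair of subspaces, the first of which is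
finite-dimensional, represents every functional on the second one. -/
lemma exists_mem_forall_eq_of_nondegenerate {E F : Type*} [AddCommGroup E] [Module ℝ E]
    [AddCommGroup F] [Module ℝ F] (B : E →ₗ[ℝ] F →ₗ[ℝ] ℝ) (X : Submodule ℝ E)
    (Y : Submodule ℝ F) [FiniteDimensional ℝ X]
    (hX : ∀ x ∈ X, (∀ y ∈ Y, B x y = 0) → x = 0)
    (hY : ∀ y ∈ Y, (∀ x ∈ X, B x y = 0) → y = 0) (ℓ : F →ₗ[ℝ] ℝ) :
    ∃ x ∈ X, ∀ y ∈ Y, B x y = ℓ y := by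
  have hp : (B.domRestrict₁₂ X Y).IsPerfPair := by
    apply LinearMap.IsPerfPair.of_injective
    · rw [injective_iff_map_eq_zero]
      intro x hx
      exact Subtype.ext <| hX x x.2 fun y hy => LinearMap.congr_fun hx ⟨y, hy⟩
    · rw [injective_iff_map_eq_zero]
      intro y hy
      exact Subtype.ext <| hY y y.2 fun x hx => LinearMap.congr_fun hy ⟨x, hx⟩
  obtain ⟨x, hx⟩ := hp.bijective_left.2 (ℓ.domRestrict Y)
  exact ⟨x, x.2, fun y hy => LinearMap.congr_fun hx ⟨y, hy⟩⟩

/-- Quasi-best approximation of Galerkin projections, with the stability constant itself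
(Kato's identity `‖P‖ = ‖1 - P‖` for oblique projections). -/
lemma norm_sub_le_of_galerkin {E : Type*} [NormedAddCommGroup E] [InnerProductSpace ℝ E]
    (b : E →ₗ[ℝ] E →ₗ[ℝ] ℝ) (S : Submodule ℝ E) {ν : ℝ} (hν : 1 ≤ ν)
    (hb : ∀ z ∈ S, ∃ φ ∈ S, (∀ w ∈ S, b w φ = ⟪w, z⟫) ∧ ∀ v, b v φ ≤ ν * ‖z‖ * ‖v‖)
    {x p q : E} (hp : p ∈ S) (hq : q ∈ S) (hgal : ∀ φ ∈ S, b (x - p) φ = 0) :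
    ‖x - p‖ ≤ ν * ‖x - q‖ := by
  have stab : ∀ y r : E, r ∈ S → (∀ φ ∈ S, b (y - r) φ = 0) → ‖r‖ ≤ ν * ‖y‖ := by
    intro y r hr hyr
    obtain ⟨φ, hφ, hrep, hbd⟩ := hb r hr
    have h1 : b y φ = ‖r‖ ^ 2 := by
      have := hyr φ hφ
      rw [map_sub, LinearMap.sub_apply, hrep r hr, real_inner_self_eq_norm_sq] at this
      linarith
    have h2 := hbd y
    rw [h1] at h2
    rcases (norm_nonneg r).eq_or_lt with h | h
    · rw [← h]; positivity
    · nlinarith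
  set e := x - p with he
  set d := p - q with hd
  have hxq : x - q = e + d := by rw [he, hd]; abel
  have hdS : d ∈ S := S.sub_mem hp hq
  rw [hxq]
  by_cases hd0 : d = 0
  · rw [hd0, add_zero]
    exact le_mul_of_one_le_left (norm_nonneg _) hν
  by_cases he0 : e = 0
  · rw [he0, norm_zero]; positivity
  have hdn : 0 < ‖d‖ := norm_pos_iff.mpr hd0
  have hen : 0 < ‖e‖ := norm_pos_iff.mpr he0
  set s := ‖e‖ / ‖d‖ with hs
  have hs0 : 0 < s := by positivity
  have hnorm : ‖s⁻¹ • e + s • d‖ = ‖e + d‖ := by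
    rw [← sq_eq_sq₀ (norm_nonneg _) (norm_nonneg _), norm_add_sq_real, norm_add_sq_real,
      norm_smul, norm_smul, real_inner_smul_left, real_inner_smul_right, norm_inv,
      Real.norm_of_nonneg hs0.le, ← mul_assoc s⁻¹, ← mul_assoc 2, mul_assoc 2 (s⁻¹ * s),
      inv_mul_cancel₀ hs0.ne', hs]
    field_simp
    ring
  have := stab (s⁻¹ • e + s • d) (s • d) (S.smul_mem _ hdS) fun φ hφ => by
    rw [add_sub_cancel_right, map_smul, LinearMap.smul_apply, hgal φ hφ, smul_zero]
  rw [hnorm, norm_smul, Real.norm_of_nonneg hs0.le, hs, div_mul_cancel₀ _ hdn.ne'] at this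
  exact this

/-- The Cauchy-Schwarz inequality in the plane. -/
lemma mul_add_mul_le_sqrt_mul_sqrt (a b c d : ℝ) :
    a * c + b * d ≤ Real.sqrt (a ^ 2 + b ^ 2) * Real.sqrt (c ^ 2 + d ^ 2) := by
  rw [← Real.sqrt_mul (by positivity)]
  apply Real.le_sqrt_of_sq_le
  nlinarith [sq_nonneg (a * d - b * c)]

lemma kappa_estimate {t s n M ε μ L : ℝ} (ht : 0 ≤ t) (hs : 0 ≤ s)
    (hM : 0 ≤ M) (hε : 0 < ε) (hμ : 1 ≤ μ) (hL : L = M * ε)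
    (hn : n ≤ μ * (t + ε * M * s)) (hs2 : ε * s ^ 2 ≤ t * n) :
    n + ε * M * s ≤ (1 + 2 * L) / (1 + L) * (1 + M * (1 + 2 * L) * μ) * μ * t := by
  rcases hM.eq_or_lt with rfl | hM
  · subst hL; simp at hn ⊢; exact hn
  have hLpos : 0 < L := hL ▸ mul_pos hM hε
  have hμ0 : 0 < μ := by linarith
  set X := ε * M * s with hX
  have hX0 : 0 ≤ X := by positivity
  set K := ε * M ^ 2 * μ with hK
  have hK0 : 0 < K := by positivity
  set θ := L / (1 + L) with hθ
  set ρ := 1 / (L * (1 + L)) with hρ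
  have hθ0 : 0 < θ := by positivity
  have hρ0 : 0 < ρ := by positivity
  have hθρ : 1 ≤ θ * (2 + ρ) := by
    have : θ * (2 + ρ) - 1 = L ^ 2 / (1 + L) ^ 2 := by
      rw [hθ, hρ]; field_simp; ring
    have : 0 ≤ L ^ 2 / (1 + L) ^ 2 := by positivity
    linarith
  have hκ : (1 + 2 * L) / (1 + L) * (1 + M * (1 + 2 * L) * μ) = 1 + θ + K * (4 + ρ) := by
    have hKL : K = L * M * μ := by rw [hK, hL]; ring
    rw [hKL, hθ, hρ]; field_simp; ring
  rw [hκ]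
  have hXX : X ^ 2 ≤ K * t * (t + X) := by
    have : ε * s ^ 2 ≤ t * (μ * (t + X)) := hs2.trans (by gcongr)
    calc X ^ 2 = ε * M ^ 2 * (ε * s ^ 2) := by rw [hX]; ring
      _ ≤ ε * M ^ 2 * (t * (μ * (t + X))) := by gcongr
      _ = _ := by rw [hK]; ring
  have key : 2 * X ≤ (θ + K * (4 + ρ)) * t := by
    by_contra! h
    have h1 : (θ + K * (2 + ρ)) * t < 2 * X - 2 * K * t := by linarith
    have h0 : 0 ≤ (θ + K * (2 + ρ)) * t := by positivity
    have h2 : ((θ + K * (2 + ρ)) * t) ^ 2 < (2 * X) * (2 * X - 2 * K * t) := by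
      have : 0 ≤ 2 * K * t := by positivity
      nlinarith
    have h3 : 4 * K ≤ (θ + K * (2 + ρ)) ^ 2 := by
      nlinarith [sq_nonneg (θ - K * (2 + ρ))]
    nlinarith [mul_le_mul_of_nonneg_right h3 (sq_nonneg t)]
  nlinarith [mul_le_mul_of_nonneg_left key hμ0.le]

section ProductNorm

variable {V₁ V₂ : Type*} [NormedAddCommGroup V₁] [NormedAddCommGroup V₂]

lemma nV_nonneg (v : V₁ × V₂) : 0 ≤ nV v := Real.sqrt_nonneg _

lemma nV_sq (v : V₁ × V₂) : nV v ^ 2 = ‖v.1‖ ^ 2 + ‖v.2‖ ^ 2 :=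
  Real.sq_sqrt (by positivity)

lemma nV_ofLp (v : WithLp 2 (V₁ × V₂)) : nV v.ofLp = ‖v‖ :=
  (WithLp.prod_norm_eq_of_L2 v).symm

end ProductNorm

section Forms

variable {V₁ V₂ Q W : Type*}
  [NormedAddCommGroup V₁] [InnerProductSpace ℝ V₁]
  [NormedAddCommGroup V₂] [InnerProductSpace ℝ V₂]
  [NormedAddCommGroup Q] [InnerProductSpace ℝ Q]
  [NormedAddCommGroup W] [InnerProductSpace ℝ W]

lemma sV_nonneg (Cs : V₂ →L[ℝ] Q) (Iop : V₁ →L[ℝ] W) (v : V₁ × V₂) : 0 ≤ sV Cs Iop v :=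
  Real.sqrt_nonneg _

lemma sV_sq (Cs : V₂ →L[ℝ] Q) (Iop : V₁ →L[ℝ] W) (v : V₁ × V₂) :
    sV Cs Iop v ^ 2 = ‖Iop v.1‖ ^ 2 + ‖Cs v.2‖ ^ 2 :=
  Real.sq_sqrt (by positivity)

lemma sV_le_mul_nV (Cs : V₂ →L[ℝ] Q) (Iop : V₁ →L[ℝ] W) {M : ℝ} (hC : ‖Cs‖ ≤ M)
    (hI : ‖Iop‖ ≤ M) (v : V₁ × V₂) : sV Cs Iop v ≤ M * nV v := by
  have hM : 0 ≤ M := (norm_nonneg _).trans hC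
  apply Real.sqrt_le_iff.mpr
  refine ⟨mul_nonneg hM (nV_nonneg v), ?_⟩
  rw [mul_pow, nV_sq, mul_add, ← mul_pow, ← mul_pow]
  gcongr
  · exact Iop.le_of_opNorm_le hI _
  · exact Cs.le_of_opNorm_le hC _

lemma abs_inner_sub_inner_le (Cs : V₂ →L[ℝ] Q) (Iop : V₁ →L[ℝ] W) {M : ℝ} (hC : ‖Cs‖ ≤ M)
    (hI : ‖Iop‖ ≤ M) (v φ : V₁ × V₂) :
    |⟪Cs v.2, Cs φ.2⟫ - ⟪Iop v.1, Iop φ.1⟫| ≤ M * nV v * sV Cs Iop φ :=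
  calc |⟪Cs v.2, Cs φ.2⟫ - ⟪Iop v.1, Iop φ.1⟫|
      ≤ |⟪Cs v.2, Cs φ.2⟫| + |⟪Iop v.1, Iop φ.1⟫| := abs_sub _ _
    _ ≤ ‖Iop v.1‖ * ‖Iop φ.1‖ + ‖Cs v.2‖ * ‖Cs φ.2‖ := by
        linarith [abs_real_inner_le_norm (Cs v.2) (Cs φ.2),
          abs_real_inner_le_norm (Iop v.1) (Iop φ.1)]
    _ ≤ sV Cs Iop v * sV Cs Iop φ := mul_add_mul_le_sqrt_mul_sqrt _ _ _ _
    _ ≤ M * nV v * sV Cs Iop φ :=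
        mul_le_mul_of_nonneg_right (sV_le_mul_nV Cs Iop hC hI v) (sV_nonneg ..)

/-- The form `bV` as a bilinear map on the `ℓ²`-product of the Hilbert spaces. -/
noncomputable def bLin (a : V₁ →L[ℝ] V₂ →L[ℝ] ℝ) (Cs : V₂ →L[ℝ] Q) (Iop : V₁ →L[ℝ] W) (α : ℝ) :
    WithLp 2 (V₁ × V₂) →ₗ[ℝ] WithLp 2 (V₁ × V₂) →ₗ[ℝ] ℝ :=
  LinearMap.mk₂ ℝ (fun v φ => bV a Cs Iop α v.ofLp φ.ofLp)
    (fun v w φ => by simp [bV, aV, inner_add_left]; ring)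
    (fun c v φ => by simp [bV, aV, inner_smul_left]; ring)
    (fun v φ ψ => by simp [bV, aV, inner_add_right]; ring)
    (fun c v φ => by simp [bV, aV, inner_smul_right]; ring)

lemma bLin_apply (a : V₁ →L[ℝ] V₂ →L[ℝ] ℝ) (Cs : V₂ →L[ℝ] Q) (Iop : V₁ →L[ℝ] W) (α : ℝ)
    (v φ : WithLp 2 (V₁ × V₂)) : bLin a Cs Iop α v φ = bV a Cs Iop α v.ofLp φ.ofLp := rfl

lemma bV_comm (a : V₁ →L[ℝ] V₂ →L[ℝ] ℝ) (Cs : V₂ →L[ℝ] Q) (Iop : V₁ →L[ℝ] W) (α : ℝ)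
    (v φ : V₁ × V₂) : bV a Cs Iop α v φ = bV a Cs Iop α φ v := by
  simp only [bV, aV, real_inner_comm (Cs v.2), real_inner_comm (Iop v.1)]
  ring

lemma bV_neg_fst (a : V₁ →L[ℝ] V₂ →L[ℝ] ℝ) (Cs : V₂ →L[ℝ] Q) (Iop : V₁ →L[ℝ] W) (α : ℝ)
    (φ : V₁ × V₂) :
    bV a Cs Iop α (-φ.1, φ.2) φ = (Real.sqrt α)⁻¹ * sV Cs Iop φ ^ 2 := by
  simp only [bV, aV, sV_sq, map_neg, neg_apply, inner_neg_left,
    real_inner_self_eq_norm_sq]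
  ring

/-- The adjoint norm on `V₂` makes `a` a contraction. -/
lemma apply_le_of_adjoint_norm (a : V₁ →L[ℝ] V₂ →L[ℝ] ℝ)
    (hadj : ∀ v₂ : V₂, ‖v₂‖ = sSup {r : ℝ | ∃ φ₁ : V₁, ‖φ₁‖ = 1 ∧ r = a φ₁ v₂})
    (v₁ : V₁) (v₂ : V₂) : a v₁ v₂ ≤ ‖v₁‖ * ‖v₂‖ := by
  by_cases h0 : v₁ = 0
  · simp [h0]
  have hn : 0 < ‖v₁‖ := norm_pos_iff.mpr h0
  have hbdd : BddAbove {r : ℝ | ∃ φ₁ : V₁, ‖φ₁‖ = 1 ∧ r = a φ₁ v₂} := by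
    refine ⟨‖a‖ * ‖v₂‖, ?_⟩
    rintro r ⟨φ, hφ, rfl⟩
    simpa [hφ] using (le_abs_self _).trans (a.le_opNorm₂ φ v₂)
  have h : a (‖v₁‖⁻¹ • v₁) v₂ ≤ ‖v₂‖ := by
    rw [hadj v₂]
    exact le_csSup hbdd ⟨_, norm_smul_inv_norm h0, rfl⟩
  rw [map_smul, smul_apply, smul_eq_mul, inv_mul_le_iff₀ hn] at h
  exact h

/-- A positive discrete inf-sup constant bounds the norm on `Vh1` by that of the represented
functional. -/
lemma discInfSup_mul_norm_le (a : V₁ →L[ℝ] V₂ →L[ℝ] ℝ) (Vh1 : Submodule ℝ V₁)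
    (Vh2 : Submodule ℝ V₂) (hpos : 0 < discInfSup a Vh1 Vh2) {v : V₁} (hv : v ∈ Vh1) {K : ℝ}
    (hK : 0 ≤ K) (h : ∀ y ∈ Vh2, a v y ≤ K * ‖y‖) : discInfSup a Vh1 Vh2 * ‖v‖ ≤ K := by
  by_cases h0 : v = 0
  · simpa [h0] using hK
  have hn : 0 < ‖v‖ := norm_pos_iff.mpr h0
  have hbdd : BddBelow {r : ℝ | ∃ v₁ ∈ Vh1, ‖v₁‖ = 1 ∧
      r = sSup {s : ℝ | ∃ φ₂ ∈ Vh2, ‖φ₂‖ = 1 ∧ s = a v₁ φ₂}} := by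
    by_contra hb
    exact hpos.ne' (Real.sInf_of_not_bddBelow hb)
  rw [← le_div_iff₀ hn]
  refine (csInf_le hbdd ⟨‖v‖⁻¹ • v, Vh1.smul_mem _ hv, norm_smul_inv_norm h0, rfl⟩).trans ?_
  refine Real.sSup_le ?_ (by positivity)
  rintro s ⟨y, hy, hy1, rfl⟩
  have := h y hy
  rw [hy1, mul_one] at this
  rw [map_smul, smul_apply, smul_eq_mul, div_eq_inv_mul]
  gcongr

lemma discInfSup_le_one (a : V₁ →L[ℝ] V₂ →L[ℝ] ℝ) (Vh1 : Submodule ℝ V₁)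
    (Vh2 : Submodule ℝ V₂) (hpos : 0 < discInfSup a Vh1 Vh2)
    (ha : ∀ v₁ v₂, a v₁ v₂ ≤ ‖v₁‖ * ‖v₂‖) : discInfSup a Vh1 Vh2 ≤ 1 := by
  have hne : {r : ℝ | ∃ v₁ ∈ Vh1, ‖v₁‖ = 1 ∧
      r = sSup {s : ℝ | ∃ φ₂ ∈ Vh2, ‖φ₂‖ = 1 ∧ s = a v₁ φ₂}}.Nonempty := by
    by_contra hb
    rw [Set.not_nonempty_iff_eq_empty] at hb
    rw [discInfSup, hb, Real.sInf_empty] at hpos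
    exact hpos.false
  obtain ⟨-, v, hv, hv1, -⟩ := hne
  simpa [hv1] using discInfSup_mul_norm_le a Vh1 Vh2 hpos hv (norm_nonneg v) fun y _ => ha v y

/-- Discrete lifting: every discrete `φ` is the image under `aV` of a discrete function whose
norm is controlled by the reciprocal `μ` of the discrete inf-sup constant. -/
lemma exists_discrete_lift (a : V₁ →L[ℝ] V₂ →L[ℝ] ℝ) (Vh1 : Submodule ℝ V₁)
    (Vh2 : Submodule ℝ V₂) [FiniteDimensional ℝ Vh1] [FiniteDimensional ℝ Vh2]
    (h1 : ∀ v₁ ∈ Vh1, (∀ φ₂ ∈ Vh2, a v₁ φ₂ = 0) → v₁ = 0)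
    (h2 : ∀ v₂ ∈ Vh2, (∀ φ₁ ∈ Vh1, a φ₁ v₂ = 0) → v₂ = 0)
    {μ : ℝ} (hμ : 0 < μ) (hμh : 1 / μ = discInfSup a Vh1 Vh2)
    {φ : V₁ × V₂} (hφ1 : φ.1 ∈ Vh1) (hφ2 : φ.2 ∈ Vh2) :
    ∃ w : V₁ × V₂, w.1 ∈ Vh1 ∧ w.2 ∈ Vh2 ∧ nV w ≤ μ * nV φ ∧ aV a w φ = nV φ ^ 2 := by
  let B : V₁ →ₗ[ℝ] V₂ →ₗ[ℝ] ℝ := a.toLinearMap₁₂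
  have lift : ∀ y ∈ Vh2, ∃ v ∈ Vh1, ‖v‖ ≤ μ * ‖y‖ ∧ ∀ u ∈ Vh2, a v u = ⟪y, u⟫ := by
    intro y _
    obtain ⟨v, hv, hvu⟩ :=
      exists_mem_forall_eq_of_nondegenerate B Vh1 Vh2 h1 h2 (innerₗ V₂ y)
    refine ⟨v, hv, ?_, hvu⟩
    have := discInfSup_mul_norm_le a Vh1 Vh2 (hμh ▸ by positivity) hv (norm_nonneg y)
      fun u hu => (hvu u hu).trans_le (real_inner_le_norm y u)
    rwa [← hμh, one_div, inv_mul_le_iff₀ hμ] at this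
  obtain ⟨w₁, hw1, hn1, hr1⟩ := lift φ.2 hφ2
  obtain ⟨w₂, hw2, hr2⟩ :=
    exists_mem_forall_eq_of_nondegenerate B.flip Vh2 Vh1 h2 h1 (innerₗ V₁ φ.1)
  have hr2 : ∀ u ∈ Vh1, a u w₂ = ⟪φ.1, u⟫ := hr2
  have hn2 : ‖w₂‖ ≤ μ * ‖φ.1‖ := by
    obtain ⟨v, hv, hnv, hrv⟩ := lift w₂ hw2
    have h := real_inner_le_norm φ.1 v
    rw [← hr2 v hv, hrv w₂ hw2, real_inner_self_eq_norm_sq] at h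
    have h' := h.trans (mul_le_mul_of_nonneg_left hnv (norm_nonneg _))
    rcases (norm_nonneg w₂).eq_or_lt with h0 | h0
    · rw [← h0]; positivity
    · nlinarith
  refine ⟨(w₁, w₂), hw1, hw2, ?_, ?_⟩
  · apply Real.sqrt_le_iff.mpr
    refine ⟨mul_nonneg hμ.le (nV_nonneg _), ?_⟩
    have e1 := pow_le_pow_left₀ (norm_nonneg _) hn1 2
    have e2 := pow_le_pow_left₀ (norm_nonneg _) hn2 2
    rw [mul_pow, nV_sq]
    simp only
    linarith
  · simp only [aV, hr1 _ hφ2, hr2 _ hφ1, nV_sq, real_inner_self_eq_norm_sq]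
    ring

/-- If a functional of norm `t` is represented on the discrete space by `bV · φ`, then `‖φ‖` and
`|φ|` are controlled by `t`. -/
lemma discrete_stability (a : V₁ →L[ℝ] V₂ →L[ℝ] ℝ) (Cs : V₂ →L[ℝ] Q) (Iop : V₁ →L[ℝ] W)
    (α : ℝ) {M : ℝ} (hC : ‖Cs‖ ≤ M) (hI : ‖Iop‖ ≤ M) (Vh1 : Submodule ℝ V₁)
    (Vh2 : Submodule ℝ V₂) [FiniteDimensional ℝ Vh1] [FiniteDimensional ℝ Vh2]
    (h1 : ∀ v₁ ∈ Vh1, (∀ φ₂ ∈ Vh2, a v₁ φ₂ = 0) → v₁ = 0)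
    (h2 : ∀ v₂ ∈ Vh2, (∀ φ₁ ∈ Vh1, a φ₁ v₂ = 0) → v₂ = 0)
    {μ : ℝ} (hμ : 0 < μ) (hμh : 1 / μ = discInfSup a Vh1 Vh2)
    {φ : V₁ × V₂} (hφ1 : φ.1 ∈ Vh1) (hφ2 : φ.2 ∈ Vh2) {t : ℝ} (ht : 0 ≤ t)
    (hb : ∀ w : V₁ × V₂, w.1 ∈ Vh1 → w.2 ∈ Vh2 → bV a Cs Iop α w φ ≤ t * nV w) :
    nV φ ≤ μ * (t + (Real.sqrt α)⁻¹ * M * sV Cs Iop φ) ∧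
      (Real.sqrt α)⁻¹ * sV Cs Iop φ ^ 2 ≤ t * nV φ := by
  have hM : 0 ≤ M := (norm_nonneg _).trans hC
  have hε : 0 ≤ (Real.sqrt α)⁻¹ := by positivity
  have hs := sV_nonneg Cs Iop φ
  constructor
  · obtain ⟨w, hw1, hw2, hwn, hwa⟩ := exists_discrete_lift a Vh1 Vh2 h1 h2 hμ hμh hφ1 hφ2
    have hbw := hb w hw1 hw2
    have hc := (neg_le_abs _).trans (abs_inner_sub_inner_le Cs Iop hC hI w φ)
    have hc' := mul_le_mul_of_nonneg_left hc hε
    rw [bV, hwa] at hbw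
    have hle : nV φ ^ 2 ≤ (t + (Real.sqrt α)⁻¹ * M * sV Cs Iop φ) * nV w := by linarith
    have hle' := hle.trans (mul_le_mul_of_nonneg_left hwn (by positivity))
    rcases (nV_nonneg φ).eq_or_lt with h0 | h0
    · rw [← h0]; positivity
    · nlinarith
  · rw [← bV_neg_fst a]
    refine (hb (-φ.1, φ.2) (Vh1.neg_mem hφ1) hφ2).trans_eq ?_
    simp [nV]

lemma bV_le_mul_nV (a : V₁ →L[ℝ] V₂ →L[ℝ] ℝ) (Cs : V₂ →L[ℝ] Q) (Iop : V₁ →L[ℝ] W)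
    (α : ℝ) {M : ℝ} (hC : ‖Cs‖ ≤ M) (hI : ‖Iop‖ ≤ M)
    (ha : ∀ v₁ v₂, a v₁ v₂ ≤ ‖v₁‖ * ‖v₂‖) (v φ : V₁ × V₂) :
    bV a Cs Iop α v φ ≤ (nV φ + (Real.sqrt α)⁻¹ * M * sV Cs Iop φ) * nV v := by
  have hε : 0 ≤ (Real.sqrt α)⁻¹ := by positivity
  have hc := mul_le_mul_of_nonneg_left
    ((le_abs_self _).trans (abs_inner_sub_inner_le Cs Iop hC hI v φ)) hε
  have haV : aV a v φ ≤ nV v * nV φ := by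
    have h := mul_add_mul_le_sqrt_mul_sqrt ‖v.1‖ ‖v.2‖ ‖φ.2‖ ‖φ.1‖
    rw [add_comm (‖φ.2‖ ^ 2)] at h
    exact (add_le_add (ha _ _) ((ha _ _).trans_eq (mul_comm _ _))).trans h
  rw [bV]
  linarith

end Forms


/-- Theorem 3.2, non-asymptotic quasi-best approximation:
`‖x − x_h‖ ≤ κ_h μ_h inf_{v_h ∈ V_h} ‖x − v_h‖`. -/
theorem stmt4
    {V₁ V₂ Q W : Type*}
    [NormedAddCommGroup V₁] [InnerProductSpace ℝ V₁] [CompleteSpace V₁] [Nontrivial V₁]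
    [NormedAddCommGroup V₂] [InnerProductSpace ℝ V₂] [CompleteSpace V₂] [Nontrivial V₂]
    [NormedAddCommGroup Q] [InnerProductSpace ℝ Q] [CompleteSpace Q]
    [NormedAddCommGroup W] [InnerProductSpace ℝ W] [CompleteSpace W]
    (a : V₁ →L[ℝ] V₂ →L[ℝ] ℝ) (Cs : V₂ →L[ℝ] Q) (Iop : V₁ →L[ℝ] W)
    (α m_a M_C M_I M L : ℝ) (hα : 0 < α)
    (hma : m_a = infSupConst a) (hma_pos : 0 < m_a)
    (hnd : ∀ v₁ : V₁, (∀ v₂ : V₂, a v₁ v₂ = 0) → v₁ = 0)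
    -- V₂ carries the adjoint norm `‖v₂‖₂ = sup_{‖φ₁‖₁=1} a(φ₁,v₂)`
    (hadj : ∀ v₂ : V₂, ‖v₂‖ = sSup {r : ℝ | ∃ φ₁ : V₁, ‖φ₁‖ = 1 ∧ r = a φ₁ v₂})
    (hMC : M_C = ‖Cs‖) (hMI : M_I = ‖Iop‖) (hM : M = max M_I M_C)
    (hL : L = M / Real.sqrt α)
    (Vh1 : Submodule ℝ V₁) (Vh2 : Submodule ℝ V₂)
    [FiniteDimensional ℝ Vh1] [FiniteDimensional ℝ Vh2]
    (hndh1 : ∀ v₁ ∈ Vh1, (∀ φ₂ ∈ Vh2, a v₁ φ₂ = 0) → v₁ = 0)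
    (hndh2 : ∀ v₂ ∈ Vh2, (∀ φ₁ ∈ Vh1, a φ₁ v₂ = 0) → v₂ = 0)
    (μh κh : ℝ) (hμh_pos : 0 < μh)
    (hμh : 1 / μh = discInfSup a Vh1 Vh2)
    (hκh : κh = ((1 + 2 * L) / (1 + L)) * (1 + M * (1 + 2 * M / Real.sqrt α) * μh))
    (u_d : W) (x xh : V₁ × V₂)
    (hx : ∀ φ : V₁ × V₂, bV a Cs Iop α x φ = -(Real.sqrt α)⁻¹ * ⟪u_d, Iop φ.1⟫)
    (hxh_mem : xh.1 ∈ Vh1 ∧ xh.2 ∈ Vh2)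
    (hxh : ∀ φh : V₁ × V₂, φh.1 ∈ Vh1 → φh.2 ∈ Vh2 →
      bV a Cs Iop α xh φh = -(Real.sqrt α)⁻¹ * ⟪u_d, Iop φh.1⟫) :
    nV (x - xh) ≤ κh * μh * bestErr Vh1 Vh2 x := by
  have hC : ‖Cs‖ ≤ M := hM ▸ hMC ▸ le_max_right _ _
  have hI : ‖Iop‖ ≤ M := hM ▸ hMI ▸ le_max_left _ _
  have hM0 : 0 ≤ M := (norm_nonneg _).trans hC
  have hε : 0 < (Real.sqrt α)⁻¹ := inv_pos.mpr (Real.sqrt_pos.mpr hα)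
  have ha := apply_le_of_adjoint_norm a hadj
  have hpos : 0 < discInfSup a Vh1 Vh2 := hμh ▸ by positivity
  have hμ1 : 1 ≤ μh := by
    have := discInfSup_le_one a Vh1 Vh2 hpos ha
    rwa [← hμh, div_le_one hμh_pos] at this
  have hL0 : 0 ≤ L := hL ▸ by positivity
  have hLε : L = M * (Real.sqrt α)⁻¹ := hL
  have hκ : κh = (1 + 2 * L) / (1 + L) * (1 + M * (1 + 2 * L) * μh) := by
    rw [hκh, hL]; ring
  have hκ1 : 1 ≤ κh := by
    rw [hκ]
    apply one_le_mul_of_one_le_of_one_le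
    · rw [one_le_div (by positivity)]; linarith
    · have : 0 ≤ M * (1 + 2 * L) * μh := by positivity
      linarith
  have hν : 1 ≤ κh * μh := one_le_mul_of_one_le_of_one_le hκ1 hμ1
  let S : Submodule ℝ (WithLp 2 (V₁ × V₂)) :=
    (Vh1.prod Vh2).map (WithLp.linearEquiv 2 ℝ (V₁ × V₂)).symm.toLinearMap
  have hS : ∀ v : WithLp 2 (V₁ × V₂), v ∈ S ↔ v.fst ∈ Vh1 ∧ v.snd ∈ Vh2 := by
    intro v
    constructor
    · rintro ⟨u, hu, rfl⟩
      exact hu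
    · intro hv
      exact ⟨v.ofLp, hv, rfl⟩
  have : FiniteDimensional ℝ (Vh1.prod Vh2) :=
    Module.Finite.iff_fg.mpr ((Module.Finite.iff_fg.mp ‹_›).prod (Module.Finite.iff_fg.mp ‹_›))
  have hnondeg : ∀ φ ∈ S, (∀ w ∈ S, bLin a Cs Iop α φ w = 0) → φ = 0 := by
    intro φ hφ h0
    obtain ⟨hst1, hst2⟩ := discrete_stability a Cs Iop α hC hI Vh1 Vh2 hndh1 hndh2 hμh_pos hμh
      ((hS φ).mp hφ).1 ((hS φ).mp hφ).2 le_rfl fun w hw1 hw2 => by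
        rw [bV_comm, zero_mul]
        exact (h0 (WithLp.toLp 2 w) ((hS _).mpr ⟨hw1, hw2⟩)).le
    have hn := kappa_estimate le_rfl (sV_nonneg Cs Iop _) hM0 hε hμ1 hLε hst1 hst2
    have hs : 0 ≤ (Real.sqrt α)⁻¹ * M * sV Cs Iop φ.ofLp :=
      mul_nonneg (by positivity) (sV_nonneg ..)
    rw [mul_zero, nV_ofLp] at hn
    exact norm_le_zero_iff.mp (by linarith)
  have hb : ∀ z ∈ S, ∃ φ ∈ S, (∀ w ∈ S, bLin a Cs Iop α w φ = ⟪w, z⟫) ∧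
      ∀ v, bLin a Cs Iop α v φ ≤ κh * μh * ‖z‖ * ‖v‖ := by
    intro z hz
    obtain ⟨φ, hφ, hrep⟩ := exists_mem_forall_eq_of_nondegenerate (bLin a Cs Iop α) S S hnondeg
      (fun y hy h => hnondeg y hy fun w hw => (bV_comm ..).trans (h w hw)) (innerₗ _ z)
    have hrep' : ∀ w ∈ S, bLin a Cs Iop α w φ = ⟪w, z⟫ := fun w hw =>
      (bV_comm ..).trans ((hrep w hw).trans (real_inner_comm w z))
    refine ⟨φ, hφ, hrep', fun v => ?_⟩
    obtain ⟨hst1, hst2⟩ := discrete_stability a Cs Iop α hC hI Vh1 Vh2 hndh1 hndh2 hμh_pos hμh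
      ((hS φ).mp hφ).1 ((hS φ).mp hφ).2 (norm_nonneg z) fun w hw1 hw2 => by
        refine (hrep' (WithLp.toLp 2 w) ((hS _).mpr ⟨hw1, hw2⟩)).trans_le ?_
        rw [mul_comm]
        exact (real_inner_le_norm _ _).trans_eq (by rw [← nV_ofLp])
    have hn := kappa_estimate (norm_nonneg z) (sV_nonneg Cs Iop _) hM0 hε hμ1 hLε hst1 hst2
    rw [← hκ] at hn
    refine (bV_le_mul_nV a Cs Iop α hC hI ha v.ofLp φ.ofLp).trans ?_
    rw [nV_ofLp v]
    exact mul_le_mul_of_nonneg_right hn (norm_nonneg v)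
  have hbest : ∀ vh : V₁ × V₂, vh.1 ∈ Vh1 → vh.2 ∈ Vh2 →
      nV (x - xh) ≤ κh * μh * nV (x - vh) := by
    intro vh hv1 hv2
    have := norm_sub_le_of_galerkin (bLin a Cs Iop α) S hν hb (x := WithLp.toLp 2 x)
      (p := WithLp.toLp 2 xh) (q := WithLp.toLp 2 vh) ((hS _).mpr hxh_mem)
      ((hS _).mpr ⟨hv1, hv2⟩) fun φ hφ => by
        rw [map_sub, LinearMap.sub_apply, bLin_apply, bLin_apply, hx,
          hxh _ ((hS φ).mp hφ).1 ((hS φ).mp hφ).2, sub_self]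
    rwa [← nV_ofLp, ← nV_ofLp] at this
  have hν0 : 0 < κh * μh := by linarith
  rw [← div_le_iff₀' hν0]
  refine le_csInf ⟨_, 0, Vh1.zero_mem, Vh2.zero_mem, rfl⟩ ?_
  rintro r ⟨vh, hv1, hv2, rfl⟩
  rw [div_le_iff₀' hν0]
  exact hbest vh hv1 hv2
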